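/- arXiv:1209.5786 — 2 statements merged into one kernel-verified Lean document; each statement's English description precedes it below -/
import Mathlib

section
/- Let T ∈ (0, ∞], K ∈ ℝ and ν ≥ 0. Let g : [0,T) → ℝ be continuous and let a : [0,T) → ℝ be continuously differentiable on [0,T) and twice continuously differentiable on (0,T), satisfying a''(s) ≥ 2K·a'(s) + ν·g(s) for every s ∈ (0,T). Then for every τ ∈ [0,T): a(τ) − a(0) + ν·∫₀^τ I_{−2K}(s)·g(s) ds ≤ a'(τ)·I_{−2K}(τ). -/
open MeasureTheory Filter Topology

/-- `I_K(t) = ∫₀ᵗ e^{Ks} ds`. -/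
noncomputable def intI (K t : ℝ) : ℝ := ∫ s in (0:ℝ)..t, Real.exp (K * s)

theorem hasDerivAt_intI (K t : ℝ) : HasDerivAt (intI K) (Real.exp (K * t)) t := by
  have h : Continuous fun s : ℝ => Real.exp (K * s) := by fun_prop
  exact intervalIntegral.integral_hasDerivAt_right (h.intervalIntegrable _ _)
    h.stronglyMeasurable.stronglyMeasurableAtFilter h.continuousAt

theorem continuous_intI (K : ℝ) : Continuous (intI K) :=
  continuous_iff_continuousAt.2 fun t => (hasDerivAt_intI K t).continuousAt

theorem intI_nonneg (K : ℝ) {t : ℝ} (ht : 0 ≤ t) : 0 ≤ intI K t :=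
  intervalIntegral.integral_nonneg ht fun _ _ => (Real.exp_pos _).le

theorem exp_eq_one_add_mul_intI (K t : ℝ) : Real.exp (K * t) = 1 + K * intI K t := by
  have h : ∫ s in (0:ℝ)..t, K * Real.exp (K * s) = Real.exp (K * t) - Real.exp (K * 0) := by
    refine intervalIntegral.integral_eq_sub_of_hasDerivAt
      (f := fun s => Real.exp (K * s)) (fun s _ => ?_)
      (Continuous.intervalIntegrable (by fun_prop) _ _)
    simpa [mul_comm] using ((hasDerivAt_id s).const_mul K).exp
  rw [intervalIntegral.integral_const_mul] at h
  simp only [mul_zero, Real.exp_zero] at h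
  unfold intI
  linarith

/-- Under the hypotheses `a'' ≥ 2K a' + ν g` on `(0,T)` (with `a ∈ C¹([0,T))`,
`a ∈ C²((0,T))`, `g` continuous on `[0,T)`), for every `τ ∈ [0,T)`:
`a(τ) - a(0) + ν ∫₀^τ I_{-2K}(s) g(s) ds ≤ a'(τ) I_{-2K}(τ)`. -/
theorem stmt2 (T : EReal) (hT : 0 < T) (K ν : ℝ) (hν : 0 ≤ ν)
    (a a' a'' g : ℝ → ℝ)
    (hg : ContinuousOn g {s : ℝ | 0 ≤ s ∧ (s : EReal) < T})
    (ha : ∀ s ∈ {s : ℝ | 0 ≤ s ∧ (s : EReal) < T},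
      HasDerivWithinAt a (a' s) {s : ℝ | 0 ≤ s ∧ (s : EReal) < T} s)
    (ha'cont : ContinuousOn a' {s : ℝ | 0 ≤ s ∧ (s : EReal) < T})
    (ha' : ∀ s ∈ {s : ℝ | 0 < s ∧ (s : EReal) < T}, HasDerivAt a' (a'' s) s)
    (ha''cont : ContinuousOn a'' {s : ℝ | 0 < s ∧ (s : EReal) < T})
    (hineq : ∀ s ∈ {s : ℝ | 0 < s ∧ (s : EReal) < T},
      a'' s ≥ 2 * K * a' s + ν * g s)
    (τ : ℝ) (hτ : 0 ≤ τ) (hτT : (τ : EReal) < T) :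
    a τ - a 0 + ν * ∫ s in (0:ℝ)..τ, intI (-(2 * K)) s * g s ≤
      a' τ * intI (-(2 * K)) τ := by
  have hlt : ∀ s : ℝ, s ≤ τ → (s : EReal) < T := fun s hs =>
    (EReal.coe_le_coe_iff.2 hs).trans_lt hτT
  have hsub : Set.Icc 0 τ ⊆ {s : ℝ | 0 ≤ s ∧ (s : EReal) < T} := fun s hs =>
    ⟨hs.1, hlt s hs.2⟩
  set L := -(2 * K) with hL
  have hIg : ContinuousOn (fun s => intI L s * g s) (Set.Icc 0 τ) :=
    (continuous_intI L).continuousOn.mul (hg.mono hsub)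
  have hint : IntegrableOn (fun s => intI L s * g s) (Set.Icc 0 τ) :=
    hIg.integrableOn_Icc
  let F : ℝ → ℝ := fun t =>
    a' t * intI L t - a t - ν * ∫ s in (0:ℝ)..t, intI L s * g s
  have hFcont : ContinuousOn F (Set.Icc 0 τ) := by
    refine (((ha'cont.mono hsub).mul (continuous_intI L).continuousOn).sub
      fun s hs => ((ha s (hsub hs)).continuousWithinAt.mono hsub)).sub
      (continuousOn_const.mul ?_)
    rw [← Set.uIcc_of_le hτ] at hint ⊢
    exact intervalIntegral.continuousOn_primitive_interval hint
  have hFderiv : ∀ s ∈ Set.Ioo 0 τ,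
      HasDerivAt F (intI L s * (a'' s - (2 * K * a' s + ν * g s))) s := by
    intro s hs
    have hnhds : Set.Icc 0 τ ∈ 𝓝 s := Icc_mem_nhds hs.1 hs.2
    have hda : HasDerivAt a (a' s) s :=
      (ha s (hsub (Set.Ioo_subset_Icc_self hs))).hasDerivAt (mem_of_superset hnhds hsub)
    have hprim : HasDerivAt (fun t => ∫ s in (0:ℝ)..t, intI L s * g s)
        (intI L s * g s) s := by
      refine intervalIntegral.integral_hasDerivAt_right ?_ ?_ (hIg.continuousAt hnhds)
      · refine ContinuousOn.intervalIntegrable (hIg.mono ?_)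
        rw [Set.uIcc_of_le hs.1.le]
        exact Set.Icc_subset_Icc_right hs.2.le
      · exact (hIg.mono Set.Ioo_subset_Icc_self).stronglyMeasurableAtFilter isOpen_Ioo s hs
    have h := (((ha' s ⟨hs.1, hlt s hs.2.le⟩).mul (hasDerivAt_intI L s)).sub hda).sub
      (hprim.const_mul ν)
    refine h.congr_deriv ?_
    rw [exp_eq_one_add_mul_intI, hL]
    ring
  have hmono : MonotoneOn F (Set.Icc 0 τ) := by
    refine monotoneOn_of_deriv_nonneg (convex_Icc 0 τ) hFcont ?_ ?_
    · rw [interior_Icc]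
      exact fun s hs => (hFderiv s hs).differentiableAt.differentiableWithinAt
    · rw [interior_Icc]
      intro s hs
      rw [(hFderiv s hs).deriv]
      exact mul_nonneg (intI_nonneg L hs.1.le)
        (sub_nonneg.2 (hineq s ⟨hs.1, hlt s hs.2.le⟩))
  have h := hmono (Set.left_mem_Icc.2 hτ) (Set.right_mem_Icc.2 hτ) hτ
  have h0 : intI L 0 = 0 := intervalIntegral.integral_same
  simp only [F, h0, intervalIntegral.integral_same, mul_zero] at h
  linarith
end

section
/- Let (X,d) be a metric space, let f : X → ℝ be bounded and Lipschitz, and let x ∈ X. Then |Df|²(x) ≥ |D⁻f|²(x) = limsup_{t↓0} ∫₀¹ ( D⁺(x,tr)/(tr) )² dr. -/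
open MeasureTheory Filter Topology
open scoped ENNReal NNReal

/-- The slope `|Df|(x) = limsup_{y→x} |f(y)-f(x)|/d(y,x)` (junk value `0` at isolated
points, where the punctured neighbourhood filter is trivial). -/
noncomputable def slopeAt {X : Type*} [MetricSpace X] (f : X → ℝ) (x : X) : ℝ :=
  limsup (fun y => |f y - f x| / dist y x) (𝓝[≠] x)

/-- The descending slope `|D⁻f|(x) = limsup_{y→x} max(f(x)-f(y),0)/d(y,x)`. -/
noncomputable def descSlopeAt {X : Type*} [MetricSpace X] (f : X → ℝ) (x : X) : ℝ :=
  limsup (fun y => max (f x - f y) 0 / dist y x) (𝓝[≠] x)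

/-- The Hopf–Lax semigroup `Q_t f(x) = inf_y ( f(y) + d²(x,y)/(2t) )` for `t > 0`,
with `Q_0 f = f`. -/
noncomputable def hopfLax {X : Type*} [MetricSpace X] (f : X → ℝ) (t : ℝ) (x : X) : ℝ :=
  if t ≤ 0 then f x else ⨅ y : X, (f y + dist x y ^ 2 / (2 * t))

/-- `D⁺(x,s)`: the supremum, over all minimizing sequences `(yₙ)` for `Q_s f(x)`, of
`limsupₙ d(x,yₙ)`. -/
noncomputable def DPlus {X : Type*} [MetricSpace X] (f : X → ℝ) (x : X) (s : ℝ) : ℝ :=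
  sSup {r : ℝ | ∃ y : ℕ → X,
    Tendsto (fun n => f (y n) + dist x (y n) ^ 2 / (2 * s)) atTop (𝓝 (hopfLax f s x)) ∧
    r = limsup (fun n => dist x (y n)) atTop}

/-- The infimum defining `Q_s f(x)` is bounded below by any lower bound of `f`. -/
lemma bddBelow_hopfLax {X : Type*} [MetricSpace X] {f : X → ℝ} {M : ℝ} (hbd : ∀ x, |f x| ≤ M)
    (x : X) {s : ℝ} (hs : 0 < s) :
    BddBelow (Set.range fun y => f y + dist x y ^ 2 / (2 * s)) := by
  refine ⟨-M, ?_⟩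
  rintro _ ⟨y, rfl⟩
  have h1 := (abs_le.1 (hbd y)).1
  have h2 : 0 ≤ dist x y ^ 2 / (2 * s) := by positivity
  show -M ≤ f y + dist x y ^ 2 / (2 * s)
  linarith

lemma hopfLax_le {X : Type*} [MetricSpace X] {f : X → ℝ} {M : ℝ} (hbd : ∀ x, |f x| ≤ M)
    (x y : X) {s : ℝ} (hs : 0 < s) :
    hopfLax f s x ≤ f y + dist x y ^ 2 / (2 * s) := by
  rw [hopfLax, if_neg (not_le.2 hs)]
  exact ciInf_le (bddBelow_hopfLax hbd x hs) y

lemma hopfLax_le_self {X : Type*} [MetricSpace X] {f : X → ℝ} {M : ℝ} (hbd : ∀ x, |f x| ≤ M)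
    (x : X) {s : ℝ} (hs : 0 < s) : hopfLax f s x ≤ f x := by
  simpa using hopfLax_le hbd x x hs

lemma le_hopfLax {X : Type*} [MetricSpace X] {f : X → ℝ} {x : X} {s b : ℝ} (hs : 0 < s)
    (h : ∀ y, b ≤ f y + dist x y ^ 2 / (2 * s)) : b ≤ hopfLax f s x := by
  have : Nonempty X := ⟨x⟩
  rw [hopfLax, if_neg (not_le.2 hs)]
  exact le_ciInf h

lemma exists_minimizing_seq {X : Type*} [MetricSpace X] {f : X → ℝ} {M : ℝ}
    (hbd : ∀ x, |f x| ≤ M) (x : X) {s : ℝ} (hs : 0 < s) :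
    ∃ y : ℕ → X, Tendsto (fun n => f (y n) + dist x (y n) ^ 2 / (2 * s)) atTop
      (𝓝 (hopfLax f s x)) := by
  have : Nonempty X := ⟨x⟩
  have h : ∀ n : ℕ, ∃ y, f y + dist x y ^ 2 / (2 * s) < hopfLax f s x + 1 / ((n : ℝ) + 1) := by
    intro n
    have hn : 0 < 1 / ((n : ℝ) + 1) := by positivity
    rw [hopfLax, if_neg (not_le.2 hs)]
    exact exists_lt_of_ciInf_lt (lt_add_of_pos_right _ hn)
  choose y hy using h
  refine ⟨y, tendsto_of_tendsto_of_tendsto_of_le_of_le tendsto_const_nhds ?_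
    (fun n => hopfLax_le hbd x (y n) hs) (fun n => (hy n).le)⟩
  simpa using tendsto_const_nhds.add (tendsto_one_div_add_atTop_nhds_zero_nat (𝕜 := ℝ))

lemma limsup_le_of_le_tendsto {u v : ℕ → ℝ} {b : ℝ} (hu : ∀ n, 0 ≤ u n) (huv : ∀ n, u n ≤ v n)
    (hv : Tendsto v atTop (𝓝 b)) : limsup u atTop ≤ b := by
  rw [← hv.limsup_eq]
  exact limsup_le_limsup (Eventually.of_forall huv)
    (isBoundedUnder_of_eventually_ge (Eventually.of_forall hu)).isCoboundedUnder_le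
    hv.isBoundedUnder_le

/-- A point whose value is close to the infimum is at distance about `2 L s` at most. -/
lemma dist_le_of_lipschitz {X : Type*} [MetricSpace X] {f : X → ℝ} {L : ℝ≥0}
    (hf : LipschitzWith L f) (x y : X) {s : ℝ} (hs : 0 < s) :
    dist x y ≤ L * s + √(2 * s * (f y + dist x y ^ 2 / (2 * s) - f x) + (L * s) ^ 2) := by
  have h1 : f x - f y ≤ L * dist x y :=
    (le_abs_self _).trans (by simpa [Real.dist_eq] using hf.dist_le_mul x y)
  have h2 : (dist x y - L * s) ^ 2 ≤
      2 * s * (f y + dist x y ^ 2 / (2 * s) - f x) + (L * s) ^ 2 := by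
    have h3 : 2 * s * (f y + dist x y ^ 2 / (2 * s) - f x) =
        dist x y ^ 2 - 2 * s * (f x - f y) := by field_simp; ring
    rw [h3]
    nlinarith
  linarith [Real.le_sqrt_of_sq_le h2]

lemma tendsto_dist_bound {X : Type*} [MetricSpace X] {f : X → ℝ} (L : ℝ≥0)
    {x : X} {s : ℝ} {y : ℕ → X}
    (hy : Tendsto (fun n => f (y n) + dist x (y n) ^ 2 / (2 * s)) atTop (𝓝 (hopfLax f s x))) :
    Tendsto (fun n => L * s +
      √(2 * s * (f (y n) + dist x (y n) ^ 2 / (2 * s) - f x) + (L * s) ^ 2)) atTop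
      (𝓝 (L * s + √(2 * s * (hopfLax f s x - f x) + (L * s) ^ 2))) :=
  ((((hy.sub_const _).const_mul _).add_const _).sqrt).const_add _

lemma limsup_dist_le {X : Type*} [MetricSpace X] {f : X → ℝ} {M : ℝ}
    (hbd : ∀ x, |f x| ≤ M) {L : ℝ≥0} (hf : LipschitzWith L f) {x : X} {s : ℝ} (hs : 0 < s)
    {y : ℕ → X}
    (hy : Tendsto (fun n => f (y n) + dist x (y n) ^ 2 / (2 * s)) atTop (𝓝 (hopfLax f s x))) :
    limsup (fun n => dist x (y n)) atTop ≤ 2 * L * s := by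
  refine (limsup_le_of_le_tendsto (fun _ => dist_nonneg)
    (fun n => dist_le_of_lipschitz hf x (y n) hs) (tendsto_dist_bound L hy)).trans ?_
  have hL : 0 ≤ L * s := by positivity
  have h : √(2 * s * (hopfLax f s x - f x) + (L * s) ^ 2) ≤ L * s :=
    Real.sqrt_le_iff.2 ⟨hL, by nlinarith [hopfLax_le_self hbd x hs]⟩
  linarith

lemma DPlus_le {X : Type*} [MetricSpace X] {f : X → ℝ} {M : ℝ}
    (hbd : ∀ x, |f x| ≤ M) {L : ℝ≥0} (hf : LipschitzWith L f) (x : X) {s : ℝ} (hs : 0 < s) :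
    DPlus f x s ≤ 2 * L * s := by
  refine Real.sSup_le ?_ (by positivity)
  rintro _ ⟨y, hy, rfl⟩
  exact limsup_dist_le hbd hf hs hy

lemma limsup_dist_le_DPlus {X : Type*} [MetricSpace X] {f : X → ℝ} {M : ℝ}
    (hbd : ∀ x, |f x| ≤ M) {L : ℝ≥0} (hf : LipschitzWith L f) {x : X} {s : ℝ} (hs : 0 < s)
    {y : ℕ → X}
    (hy : Tendsto (fun n => f (y n) + dist x (y n) ^ 2 / (2 * s)) atTop (𝓝 (hopfLax f s x))) :
    limsup (fun n => dist x (y n)) atTop ≤ DPlus f x s := by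
  refine le_csSup ⟨2 * L * s, ?_⟩ ⟨y, hy, rfl⟩
  rintro _ ⟨z, hz, rfl⟩
  exact limsup_dist_le hbd hf hs hz

/-- The difference quotient of `Q` in the variable `1 / (2 s)` dominates `D⁺(x,s)²` at the
smaller time. -/
lemma DPlus_le_sqrt {X : Type*} [MetricSpace X] {f : X → ℝ} {M : ℝ}
    (hbd : ∀ x, |f x| ≤ M) (x : X) {s s' : ℝ} (hs : 0 < s) (hss : s < s') :
    DPlus f x s ≤ √((hopfLax f s x - hopfLax f s' x) / (1 / (2 * s) - 1 / (2 * s'))) := by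
  have hu : 0 < 1 / (2 * s) - 1 / (2 * s') :=
    sub_pos.2 (one_div_lt_one_div_of_lt (by linarith) (by linarith))
  refine Real.sSup_le ?_ (Real.sqrt_nonneg _)
  rintro _ ⟨y, hy, rfl⟩
  refine limsup_le_of_le_tendsto (fun _ => dist_nonneg) (fun n => ?_)
    (((hy.sub_const (hopfLax f s' x)).div_const (1 / (2 * s) - 1 / (2 * s'))).sqrt)
  refine Real.le_sqrt_of_sq_le ((le_div_iff₀ hu).2 ?_)
  have h := hopfLax_le hbd x (y n) (hs.trans hss)
  rw [div_eq_mul_one_div] at h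
  rw [div_eq_mul_one_div (dist x (y n) ^ 2)]
  linarith

/-- The difference quotient of `Q` in the variable `1 / (2 s)` is dominated by `D⁺(x,s)²` at the
larger time. -/
lemma sqrt_le_DPlus {X : Type*} [MetricSpace X] {f : X → ℝ} {M : ℝ}
    (hbd : ∀ x, |f x| ≤ M) {L : ℝ≥0} (hf : LipschitzWith L f) (x : X) {s s' : ℝ} (hs : 0 < s)
    (hss : s < s') :
    √((hopfLax f s x - hopfLax f s' x) / (1 / (2 * s) - 1 / (2 * s'))) ≤ DPlus f x s' := by
  have hu : 0 < 1 / (2 * s) - 1 / (2 * s') :=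
    sub_pos.2 (one_div_lt_one_div_of_lt (by linarith) (by linarith))
  have hs' := hs.trans hss
  obtain ⟨y, hy⟩ := exists_minimizing_seq hbd x hs'
  refine le_trans ?_ (limsup_dist_le_DPlus hbd hf hs' hy)
  have hlim := (((hy.const_sub (hopfLax f s x)).div_const
    (1 / (2 * s) - 1 / (2 * s'))).sqrt)
  rw [← hlim.limsup_eq]
  refine limsup_le_limsup (Eventually.of_forall fun n => ?_)
    hlim.isBoundedUnder_ge.isCoboundedUnder_le
    ((tendsto_dist_bound L hy).isBoundedUnder_le.mono_le
      (Eventually.of_forall fun n => dist_le_of_lipschitz hf x (y n) hs'))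
  refine Real.sqrt_le_iff.2 ⟨dist_nonneg, (div_le_iff₀ hu).2 ?_⟩
  have h := hopfLax_le hbd x (y n) hs
  rw [div_eq_mul_one_div] at h
  rw [div_eq_mul_one_div (dist x (y n) ^ 2)]
  linarith

lemma DPlus_nonneg {X : Type*} [MetricSpace X] {f : X → ℝ} {M : ℝ}
    (hbd : ∀ x, |f x| ≤ M) {L : ℝ≥0} (hf : LipschitzWith L f) (x : X) {s : ℝ} (hs : 0 < s) :
    0 ≤ DPlus f x s :=
  (Real.sqrt_nonneg _).trans (sqrt_le_DPlus hbd hf x (half_pos hs) (half_lt_self hs))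

lemma monotoneOn_DPlus {X : Type*} [MetricSpace X] {f : X → ℝ} {M : ℝ}
    (hbd : ∀ x, |f x| ≤ M) {L : ℝ≥0} (hf : LipschitzWith L f) (x : X) :
    MonotoneOn (DPlus f x) (Set.Ioi 0) := by
  intro s hs s' _ hss
  rcases hss.eq_or_lt with rfl | h
  · exact le_rfl
  · exact (DPlus_le_sqrt hbd x hs h).trans (sqrt_le_DPlus hbd hf x hs h)

lemma hopfLax_sub_bounds {X : Type*} [MetricSpace X] {f : X → ℝ} {M : ℝ}
    (hbd : ∀ x, |f x| ≤ M) {L : ℝ≥0} (hf : LipschitzWith L f) (x : X) {s s' : ℝ} (hs : 0 < s)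
    (hss : s < s') :
    DPlus f x s ^ 2 * (1 / (2 * s) - 1 / (2 * s')) ≤ hopfLax f s x - hopfLax f s' x ∧
      hopfLax f s x - hopfLax f s' x ≤ DPlus f x s' ^ 2 * (1 / (2 * s) - 1 / (2 * s')) := by
  have hu : 0 < 1 / (2 * s) - 1 / (2 * s') :=
    sub_pos.2 (one_div_lt_one_div_of_lt (by linarith) (by linarith))
  have hanti : hopfLax f s' x ≤ hopfLax f s x := by
    refine le_hopfLax hs fun y => (hopfLax_le hbd x y (hs.trans hss)).trans ?_
    gcongr
  have hc : 0 ≤ (hopfLax f s x - hopfLax f s' x) / (1 / (2 * s) - 1 / (2 * s')) :=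
    div_nonneg (sub_nonneg.2 hanti) hu.le
  constructor
  · rw [← le_div_iff₀ hu, ← Real.sq_sqrt hc]
    exact pow_le_pow_left₀ (DPlus_nonneg hbd hf x hs) (DPlus_le_sqrt hbd x hs hss) 2
  · rw [← div_le_iff₀ hu, ← Real.sq_sqrt hc]
    exact pow_le_pow_left₀ (Real.sqrt_nonneg _) (sqrt_le_DPlus hbd hf x hs hss) 2

lemma abs_hopfLax_sub_le {X : Type*} [MetricSpace X] {f : X → ℝ} {M : ℝ}
    (hbd : ∀ x, |f x| ≤ M) {L : ℝ≥0} (hf : LipschitzWith L f) (x : X) {s s' : ℝ} (hs : 0 < s)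
    (hs' : 0 < s') :
    |hopfLax f s' x - hopfLax f s x - DPlus f x s ^ 2 * (1 / (2 * s') - 1 / (2 * s))| ≤
      |DPlus f x s' ^ 2 - DPlus f x s ^ 2| * |1 / (2 * s') - 1 / (2 * s)| := by
  rw [← abs_mul]
  rcases lt_trichotomy s s' with h | rfl | h
  · obtain ⟨h1, h2⟩ := hopfLax_sub_bounds hbd hf x hs h
    rw [abs_le]
    constructor
    · linarith [neg_abs_le ((DPlus f x s' ^ 2 - DPlus f x s ^ 2) *
        (1 / (2 * s') - 1 / (2 * s)))]
    · linarith [abs_nonneg ((DPlus f x s' ^ 2 - DPlus f x s ^ 2) *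
        (1 / (2 * s') - 1 / (2 * s)))]
  · simp
  · obtain ⟨h1, h2⟩ := hopfLax_sub_bounds hbd hf x hs' h
    rw [abs_le]
    constructor
    · linarith [neg_abs_le ((DPlus f x s' ^ 2 - DPlus f x s ^ 2) *
        (1 / (2 * s') - 1 / (2 * s)))]
    · linarith [abs_nonneg ((DPlus f x s' ^ 2 - DPlus f x s ^ 2) *
        (1 / (2 * s') - 1 / (2 * s)))]

lemma hasDerivAt_one_div_two_mul {s : ℝ} (hs : 0 < s) :
    HasDerivAt (fun r : ℝ => 1 / (2 * r)) (-(1 / (2 * s ^ 2))) s := by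
  have h := (((hasDerivAt_id s).const_mul 2).inv (by simpa using hs.ne'))
  simp only [one_div]
  refine h.congr_deriv ?_
  simp only [id]
  field_simp

lemma hasDerivAt_hopfLax {X : Type*} [MetricSpace X] {f : X → ℝ} {M : ℝ}
    (hbd : ∀ x, |f x| ≤ M) {L : ℝ≥0} (hf : LipschitzWith L f) (x : X) {s : ℝ} (hs : 0 < s)
    (hc : ContinuousAt (DPlus f x) s) :
    HasDerivAt (fun r => hopfLax f r x) (-(1 / 2) * (DPlus f x s / s) ^ 2) s := by
  have hu := hasDerivAt_one_div_two_mul hs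
  have hzero : HasDerivAt
      (fun r => hopfLax f r x - DPlus f x s ^ 2 * (1 / (2 * r))) 0 s := by
    rw [hasDerivAt_iff_isLittleO]
    have h1 : (fun r => DPlus f x r ^ 2 - DPlus f x s ^ 2) =o[𝓝 s] fun _ => (1 : ℝ) := by
      rw [Asymptotics.isLittleO_one_iff]
      have h0 : Tendsto (fun r => DPlus f x r ^ 2 - DPlus f x s ^ 2) (𝓝 s)
          (𝓝 (DPlus f x s ^ 2 - DPlus f x s ^ 2)) := (hc.pow 2).tendsto.sub_const _
      rwa [sub_self] at h0
    have h2 := h1.mul_isBigO hu.differentiableAt.isBigO_sub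
    simp only [one_mul] at h2
    refine Asymptotics.IsBigO.trans_isLittleO (Asymptotics.IsBigO.of_bound 1 ?_) h2
    filter_upwards [lt_mem_nhds hs] with r hr
    rw [one_mul, norm_mul, Real.norm_eq_abs, Real.norm_eq_abs, Real.norm_eq_abs]
    refine le_trans (le_of_eq ?_) (abs_hopfLax_sub_le hbd hf x hs hr)
    congr 1
    simp only [smul_zero]
    ring
  have h := hzero.add (hu.const_mul (DPlus f x s ^ 2))
  refine (h.congr_deriv ?_).congr_of_eventuallyEq (Eventually.of_forall fun r => ?_)
  · field_simp
    ring
  · simp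

lemma continuousAt_hopfLax {X : Type*} [MetricSpace X] {f : X → ℝ} {M : ℝ}
    (hbd : ∀ x, |f x| ≤ M) {L : ℝ≥0} (hf : LipschitzWith L f) (x : X) {s : ℝ} (hs : 0 < s) :
    ContinuousAt (fun r => hopfLax f r x) s := by
  have hu := (hasDerivAt_one_div_two_mul hs).continuousAt.tendsto
  have hz : Tendsto (fun r : ℝ => 1 / (2 * r) - 1 / (2 * s)) (𝓝 s) (𝓝 0) := by
    simpa using hu.sub_const (1 / (2 * s))
  have h1 : Tendsto (fun r => hopfLax f r x - hopfLax f s x -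
      DPlus f x s ^ 2 * (1 / (2 * r) - 1 / (2 * s))) (𝓝 s) (𝓝 0) := by
    refine squeeze_zero_norm' (a := fun r => ((2 * L * (2 * s)) ^ 2 + DPlus f x s ^ 2) *
      |1 / (2 * r) - 1 / (2 * s)|) ?_ (by simpa using hz.abs.const_mul _)
    filter_upwards [lt_mem_nhds hs, gt_mem_nhds (show s < 2 * s by linarith)] with r hr hr2
    refine (abs_hopfLax_sub_le hbd hf x hs hr).trans ?_
    gcongr
    have h2 : DPlus f x r ≤ 2 * L * (2 * s) := (DPlus_le hbd hf x hr).trans (by gcongr)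
    have h3 := pow_le_pow_left₀ (DPlus_nonneg hbd hf x hr) h2 2
    rw [abs_le]
    constructor <;> nlinarith [sq_nonneg (DPlus f x s), sq_nonneg (DPlus f x r)]
  have h2 := (h1.add (hz.const_mul (DPlus f x s ^ 2))).add_const (hopfLax f s x)
  simpa [ContinuousAt] using h2

/-- If `f` descends from `x` at rate at most `c` near `x`, then `Q_t f(x)` descends at rate at
most `c² / 2` for small `t`. -/
lemma sub_hopfLax_le {X : Type*} [MetricSpace X] {f : X → ℝ} {L : ℝ≥0}
    (hf : LipschitzWith L f) (x : X) {c δ t : ℝ} (ht : 0 < t) (htδ : 2 * L * t ≤ δ)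
    (h : ∀ y, dist y x < δ → f x - f y ≤ c * dist y x) :
    f x - hopfLax f t x ≤ c ^ 2 * t / 2 := by
  suffices f x - c ^ 2 * t / 2 ≤ hopfLax f t x by linarith
  refine le_hopfLax ht fun y => ?_
  rw [dist_comm x y]
  have h0 : 0 ≤ c ^ 2 * t / 2 := by positivity
  rcases lt_or_ge (dist y x) δ with hd | hd
  · have h1 := h y hd
    have h2 : 0 ≤ (dist y x - t * c) ^ 2 / (2 * t) := by positivity
    have h3 : (dist y x - t * c) ^ 2 / (2 * t) =
        dist y x ^ 2 / (2 * t) - c * dist y x + c ^ 2 * t / 2 := by field_simp; ring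
    linarith
  · have h1 : f x - f y ≤ L * dist y x :=
      (le_abs_self _).trans (by simpa [Real.dist_eq, dist_comm x y] using hf.dist_le_mul x y)
    have h2 : L * dist y x ≤ dist y x ^ 2 / (2 * t) := by
      rw [le_div_iff₀ (by positivity)]
      nlinarith [dist_nonneg (x := y) (y := x)]
    linarith

lemma continuousOn_hopfLax {X : Type*} [MetricSpace X] {f : X → ℝ} {M : ℝ}
    (hbd : ∀ x, |f x| ≤ M) {L : ℝ≥0} (hf : LipschitzWith L f) (x : X) (t : ℝ) :
    ContinuousOn (fun r => hopfLax f r x) (Set.Icc 0 t) := by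
  intro s hs
  rcases hs.1.eq_or_lt with rfl | hpos
  · have h0 : hopfLax f 0 x = f x := by simp [hopfLax]
    have hl : Tendsto (fun r : ℝ => f x - L ^ 2 * r / 2) (𝓝[Set.Icc 0 t] 0) (𝓝 (f x)) := by
      have : Continuous fun r : ℝ => f x - L ^ 2 * r / 2 := by fun_prop
      simpa using (this.tendsto 0).mono_left nhdsWithin_le_nhds
    rw [ContinuousWithinAt, h0]
    refine tendsto_of_tendsto_of_tendsto_of_le_of_le' hl tendsto_const_nhds ?_ ?_ <;>
    filter_upwards [self_mem_nhdsWithin] with r hr <;>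
    rcases hr.1.eq_or_lt with rfl | hr0
    · simp [h0]
    · have := sub_hopfLax_le hf x (c := L) hr0 le_rfl fun y _ =>
        (le_abs_self _).trans (by simpa [Real.dist_eq, dist_comm x y] using hf.dist_le_mul x y)
      linarith
    · exact h0.le
    · exact hopfLax_le_self hbd x hr0
  · exact (continuousAt_hopfLax hbd hf x hpos).continuousWithinAt

lemma intervalIntegrable_DPlus_div_sq {X : Type*} [MetricSpace X] {f : X → ℝ} {M : ℝ}
    (hbd : ∀ x, |f x| ≤ M) {L : ℝ≥0} (hf : LipschitzWith L f) (x : X) {t : ℝ} (ht : 0 ≤ t) :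
    IntervalIntegrable (fun s => (DPlus f x s / s) ^ 2) volume 0 t := by
  rw [intervalIntegrable_iff_integrableOn_Ioc_of_le ht]
  have hm : AEMeasurable (DPlus f x) (volume.restrict (Set.Ioc 0 t)) :=
    aemeasurable_restrict_of_monotoneOn measurableSet_Ioc
      ((monotoneOn_DPlus hbd hf x).mono Set.Ioc_subset_Ioi_self)
  refine Integrable.of_bound ((hm.div aemeasurable_id).pow_const 2).aestronglyMeasurable
    ((2 * L) ^ 2) ?_
  filter_upwards [ae_restrict_mem measurableSet_Ioc] with s hs
  have h1 : DPlus f x s / s ≤ 2 * L := (div_le_iff₀ hs.1).2 (DPlus_le hbd hf x hs.1)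
  have h0 : 0 ≤ DPlus f x s / s := div_nonneg (DPlus_nonneg hbd hf x hs.1) hs.1.le
  rw [Real.norm_of_nonneg (sq_nonneg _)]
  exact pow_le_pow_left₀ h0 h1 2

/-- The integral form of the Hamilton–Jacobi identity `∂ₛ Q_s f(x) = - (D⁺(x,s)/s)² / 2`. -/
lemma integral_DPlus_div_sq {X : Type*} [MetricSpace X] {f : X → ℝ} {M : ℝ}
    (hbd : ∀ x, |f x| ≤ M) {L : ℝ≥0} (hf : LipschitzWith L f) (x : X) {t : ℝ} (ht : 0 ≤ t) :
    ∫ s in (0:ℝ)..t, (DPlus f x s / s) ^ 2 = 2 * (f x - hopfLax f t x) := by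
  have h := integral_eq_of_hasDerivAt_off_countable_of_le (fun r => hopfLax f r x)
    (fun s => -(1 / 2) * (DPlus f x s / s) ^ 2) ht
    (monotoneOn_DPlus hbd hf x).countable_not_continuousWithinAt
    (continuousOn_hopfLax hbd hf x t) (fun s hs => ?_)
    ((intervalIntegrable_DPlus_div_sq hbd hf x ht).const_mul _)
  · rw [intervalIntegral.integral_const_mul] at h
    have h0 : hopfLax f 0 x = f x := by simp [hopfLax]
    rw [h0] at h
    linarith
  · have hpos : 0 < s := hs.1.1
    refine hasDerivAt_hopfLax hbd hf x hpos ?_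
    by_contra hc
    exact hs.2 ⟨hpos, fun hw => hc (hw.continuousAt (Ioi_mem_nhds hpos))⟩

lemma integral_DPlus_rescaled {X : Type*} [MetricSpace X] {f : X → ℝ} {M : ℝ}
    (hbd : ∀ x, |f x| ≤ M) {L : ℝ≥0} (hf : LipschitzWith L f) (x : X) {t : ℝ} (ht : 0 < t) :
    ∫ r in (0:ℝ)..1, (DPlus f x (t * r) / (t * r)) ^ 2 = 2 * (f x - hopfLax f t x) / t := by
  rw [intervalIntegral.integral_comp_mul_left (fun s => (DPlus f x s / s) ^ 2) ht.ne',
    mul_zero, mul_one, integral_DPlus_div_sq hbd hf x ht.le, smul_eq_mul]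
  field_simp

lemma abs_sub_div_dist_le {X : Type*} [MetricSpace X] {f : X → ℝ} {L : ℝ≥0}
    (hf : LipschitzWith L f) (x y : X) : |f y - f x| / dist y x ≤ L :=
  div_le_of_le_mul₀ dist_nonneg L.2 (by simpa [Real.dist_eq] using hf.dist_le_mul y x)

lemma max_sub_div_dist_le_abs {X : Type*} [MetricSpace X] (f : X → ℝ) (x y : X) :
    max (f x - f y) 0 / dist y x ≤ |f y - f x| / dist y x := by
  gcongr
  rw [abs_sub_comm]
  exact max_le (le_abs_self _) (abs_nonneg _)

lemma isBoundedUnder_descSlope {X : Type*} [MetricSpace X] {f : X → ℝ} {L : ℝ≥0}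
    (hf : LipschitzWith L f) (x : X) :
    IsBoundedUnder (· ≤ ·) (𝓝[≠] x) fun y => max (f x - f y) 0 / dist y x :=
  isBoundedUnder_of_eventually_le (Eventually.of_forall fun y =>
    (max_sub_div_dist_le_abs f x y).trans (abs_sub_div_dist_le hf x y))

lemma descSlopeAt_nonneg {X : Type*} [MetricSpace X] {f : X → ℝ} {L : ℝ≥0}
    (hf : LipschitzWith L f) (x : X) : 0 ≤ descSlopeAt f x := by
  rcases eq_or_neBot (𝓝[≠] x) with h | h
  · simp [descSlopeAt, h, limsup, limsSup]
  · exact le_limsup_of_frequently_le (Eventually.of_forall fun y => by positivity).frequently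
      (isBoundedUnder_descSlope hf x)

lemma descSlopeAt_le_slopeAt {X : Type*} [MetricSpace X] {f : X → ℝ} {L : ℝ≥0}
    (hf : LipschitzWith L f) (x : X) : descSlopeAt f x ≤ slopeAt f x := by
  rcases eq_or_neBot (𝓝[≠] x) with h | h
  · simp [descSlopeAt, slopeAt, h, limsup, limsSup]
  · exact limsup_le_limsup (Eventually.of_forall fun y => max_sub_div_dist_le_abs f x y)
      (isBoundedUnder_of_eventually_ge (a := 0)
        (Eventually.of_forall fun y => by positivity)).isCoboundedUnder_le
      (isBoundedUnder_of_eventually_le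
        (Eventually.of_forall fun y => abs_sub_div_dist_le hf x y))

lemma eventually_hopfLax_quotient_le {X : Type*} [MetricSpace X] {f : X → ℝ} {L : ℝ≥0}
    (hf : LipschitzWith L f) (x : X) {c : ℝ} (hc : descSlopeAt f x < c) :
    ∀ᶠ t in 𝓝[>] (0:ℝ), 2 * (f x - hopfLax f t x) / t ≤ c ^ 2 := by
  have h := eventually_lt_of_limsup_lt hc (isBoundedUnder_descSlope hf x)
  rw [eventually_nhdsWithin_iff, Metric.eventually_nhds_iff] at h
  obtain ⟨δ, hδ, h⟩ := h
  have hlim : Tendsto (fun t : ℝ => 2 * L * t) (𝓝[>] 0) (𝓝 0) := by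
    have : Continuous fun t : ℝ => 2 * (L : ℝ) * t := by fun_prop
    simpa using (this.tendsto 0).mono_left nhdsWithin_le_nhds
  filter_upwards [self_mem_nhdsWithin, hlim.eventually (gt_mem_nhds hδ)] with t ht htδ
  have := sub_hopfLax_le hf x (c := c) ht htδ.le fun y hy => ?_
  · rw [div_le_iff₀ ht]
    linarith
  · rcases eq_or_ne y x with rfl | hne
    · simp
    · exact (le_max_left _ _).trans ((div_lt_iff₀ (dist_pos.2 hne)).1 (h hy hne)).le

lemma frequently_le_hopfLax_quotient {X : Type*} [MetricSpace X] {f : X → ℝ} {M : ℝ}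
    (hbd : ∀ x, |f x| ≤ M) (x : X) {c : ℝ} (hc0 : 0 < c) (hc : c < descSlopeAt f x) :
    ∃ᶠ t in 𝓝[>] (0:ℝ), c ^ 2 ≤ 2 * (f x - hopfLax f t x) / t := by
  have hne : (𝓝[≠] x).NeBot := by
    rcases eq_or_neBot (𝓝[≠] x) with h | h
    · have : descSlopeAt f x = 0 := by simp [descSlopeAt, h, limsup, limsSup]
      linarith
    · exact h
  have h := frequently_lt_of_lt_limsup (isBoundedUnder_of_eventually_ge (a := 0)
    (Eventually.of_forall fun y => by positivity)).isCoboundedUnder_le hc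
  have hlim : Tendsto (fun y => dist y x / c) (𝓝[≠] x) (𝓝[>] 0) := by
    refine tendsto_nhdsWithin_iff.2 ⟨?_, ?_⟩
    · have : Continuous fun y => dist y x / c := by fun_prop
      simpa using (this.tendsto x).mono_left nhdsWithin_le_nhds
    · filter_upwards [self_mem_nhdsWithin] with y hy
      exact div_pos (dist_pos.2 hy) hc0
  refine hlim.frequently ((h.and_eventually self_mem_nhdsWithin).mono ?_)
  rintro y ⟨hy, hyx⟩
  have hd : 0 < dist y x := dist_pos.2 hyx
  have ht : 0 < dist y x / c := div_pos hd hc0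
  rw [lt_div_iff₀ hd] at hy
  have hdesc : c * dist y x < f x - f y :=
    (lt_max_iff.1 hy).resolve_right (not_lt.2 (by positivity))
  have hQ := hopfLax_le hbd x y ht
  have hval : dist x y ^ 2 / (2 * (dist y x / c)) = c * dist y x / 2 := by
    rw [dist_comm x y]
    field_simp
  rw [hval] at hQ
  rw [le_div_iff₀ ht]
  have : c ^ 2 * (dist y x / c) = c * dist y x := by field_simp
  linarith

lemma limsup_hopfLax_quotient {X : Type*} [MetricSpace X] {f : X → ℝ} {M : ℝ}
    (hbd : ∀ x, |f x| ≤ M) {L : ℝ≥0} (hf : LipschitzWith L f) (x : X) :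
    limsup (fun t => 2 * (f x - hopfLax f t x) / t) (𝓝[>] (0:ℝ)) = descSlopeAt f x ^ 2 := by
  have hpos : ∀ᶠ t in 𝓝[>] (0:ℝ), 0 ≤ 2 * (f x - hopfLax f t x) / t := by
    filter_upwards [self_mem_nhdsWithin] with t ht
    have h1 := hopfLax_le_self hbd x ht
    exact div_nonneg (by linarith) (le_of_lt ht)
  have hbound : IsBoundedUnder (· ≤ ·) (𝓝[>] (0:ℝ)) fun t => 2 * (f x - hopfLax f t x) / t :=
    isBoundedUnder_of_eventually_le
      (eventually_hopfLax_quotient_le hf x (lt_add_one (descSlopeAt f x)))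
  have hsq : Continuous fun c : ℝ => c ^ 2 := by fun_prop
  refine le_antisymm ?_ ?_
  · refine ge_of_tendsto ((hsq.tendsto (descSlopeAt f x)).mono_left
      (nhdsWithin_le_nhds (s := Set.Ioi (descSlopeAt f x)))) ?_
    filter_upwards [self_mem_nhdsWithin] with c hc
    exact limsup_le_of_le (isBoundedUnder_of_eventually_ge hpos).isCoboundedUnder_le
      (eventually_hopfLax_quotient_le hf x hc)
  · rcases (descSlopeAt_nonneg hf x).eq_or_lt with h0 | h0
    · rw [← h0, zero_pow two_ne_zero]
      exact le_limsup_of_frequently_le hpos.frequently hbound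
    · refine le_of_tendsto ((hsq.tendsto (descSlopeAt f x)).mono_left
        (nhdsWithin_le_nhds (s := Set.Iio (descSlopeAt f x)))) ?_
      filter_upwards [self_mem_nhdsWithin, nhdsWithin_le_nhds (lt_mem_nhds h0)] with c hc hc0
      exact le_limsup_of_frequently_le (frequently_le_hopfLax_quotient hbd x hc0 hc) hbound

/-- For `f` bounded and Lipschitz on a metric space:
`|Df|²(x) ≥ |D⁻f|²(x) = limsup_{t↓0} ∫₀¹ (D⁺(x,tr)/(tr))² dr`. -/
theorem stmt9 {X : Type*} [MetricSpace X] (f : X → ℝ)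
    (M : ℝ) (hbd : ∀ x, |f x| ≤ M) (L : ℝ≥0) (hf : LipschitzWith L f) (x : X) :
    slopeAt f x ^ 2 ≥ descSlopeAt f x ^ 2 ∧
    descSlopeAt f x ^ 2 =
      limsup (fun t => ∫ r in (0:ℝ)..1, (DPlus f x (t * r) / (t * r)) ^ 2)
        (𝓝[>] (0:ℝ)) := by
  refine ⟨pow_le_pow_left₀ (descSlopeAt_nonneg hf x) (descSlopeAt_le_slopeAt hf x) 2, ?_⟩
  rw [← limsup_hopfLax_quotient hbd hf x]
  refine limsup_congr ?_
  filter_upwards [self_mem_nhdsWithin] with t ht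
  exact (integral_DPlus_rescaled hbd hf x ht).symm
end
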